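/- arXiv:1601.07404 — 2 statements merged into one kernel-verified Lean document; each statement's English description precedes it below -/
import Mathlib

section
/- Let (A,H,D) admit a ν-twisted real structure J with signs ε, ε′, i.e.: π∘ν̂ = ν̄∘π for an algebra automorphism ν̂ of A, J is an anti-linear bijection with J² = ε·id, and for all a,b ∈ A: [π(a), Jπ(b)J⁻¹] = 0; [D,π(a)] J ν̄²(π(b)) J⁻¹ = J π(b) J⁻¹ [D,π(a)]; D J ν = ε′ ν J D; and ν J ν = J. For α ∈ Ω¹_D set D_α = D + α + ε′ ν J α J⁻¹ ν. Then (A,H,D_α) admits the same J as a ν-twisted real structure with the same signs: for all a,b ∈ A, [D_α,π(a)] J ν̄²(π(b)) J⁻¹ = J π(b) J⁻¹ [D_α,π(a)] and D_α J ν = ε′ ν J D_α. Moreover, if γ is a linear operator on H with γ² = id, [γ,π(a)] = 0 for all a ∈ A, γD = −Dγ, γν = νγ and γJ = ε″Jγ (ε″ ∈ {+1,−1}), then also γD_α = −D_αγ. -/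
/-- Conjugation of a linear endomorphism by an anti-linear bijection `J`:
`φ ↦ J ∘ φ ∘ J⁻¹`, which is again a linear endomorphism. -/
noncomputable def conjAL {H : Type*} [AddCommGroup H] [Module ℂ H]
    (J : H ≃ₗ⋆[ℂ] H) (φ : Module.End ℂ H) : Module.End ℂ H where
  toFun h := J (φ (J.symm h))
  map_add' x y := by simp
  map_smul' c x := by
    simp only [LinearEquiv.map_smulₛₗ, LinearMap.map_smulₛₗ, RingHom.id_apply,
      starRingEnd_apply, star_star, LinearMap.map_smul]

/-- The bimodule of one-forms `Ω¹_D = { Σᵢ π(aᵢ)[D,π(bᵢ)] }`. -/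
def Omega1 {A H : Type*} [Ring A] [Algebra ℂ A]
    [AddCommGroup H] [Module ℂ H]
    (π : A →ₐ[ℂ] Module.End ℂ H) (D : Module.End ℂ H) : Set (Module.End ℂ H) :=
  {x | ∃ (n : ℕ) (a b : Fin n → A),
    x = ∑ i, π (a i) * (D * π (b i) - π (b i) * D)}

section TwistedReal

variable {A H : Type*} [Ring A] [Algebra ℂ A] [AddCommGroup H] [Module ℂ H]

theorem conjAL_apply (J : H ≃ₗ⋆[ℂ] H) (φ : Module.End ℂ H) (h : H) :
    conjAL J φ h = J (φ (J.symm h)) := rfl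

theorem conjAL_mul (J : H ≃ₗ⋆[ℂ] H) (φ ψ : Module.End ℂ H) :
    conjAL J (φ * ψ) = conjAL J φ * conjAL J ψ := by
  ext h
  simp [conjAL_apply]

theorem conj_eq_self_of_sign {ε : ℂ} (hε : ε = 1 ∨ ε = -1) : (starRingEnd ℂ) ε = ε := by
  rcases hε with rfl | rfl <;> simp

theorem mul_self_eq_one_of_sign {ε : ℂ} (hε : ε = 1 ∨ ε = -1) : ε * ε = 1 := by
  rcases hε with rfl | rfl <;> simp

theorem conjAL_conjAL {J : H ≃ₗ⋆[ℂ] H} {ε : ℂ} (hε : ε = 1 ∨ ε = -1)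
    (hJ2 : ∀ h : H, J (J h) = ε • h) (φ : Module.End ℂ H) :
    conjAL J (conjAL J φ) = φ := by
  ext h
  have hs : J.symm (J.symm h) = ε • h := by
    rw [J.symm_apply_eq, J.symm_apply_eq, LinearEquiv.map_smulₛₗ, LinearEquiv.map_smulₛₗ, hJ2,
      smul_smul, conj_eq_self_of_sign hε, conj_eq_self_of_sign hε, mul_self_eq_one_of_sign hε,
      one_smul]
  rw [conjAL_apply, conjAL_apply, hs, hJ2, map_smul, smul_smul, mul_self_eq_one_of_sign hε,
    one_smul]

/-- One-forms inherit the twisted first-order condition. -/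
theorem Omega1.mul_eq_mul {π : A →ₐ[ℂ] Module.End ℂ H} {D α S T : Module.End ℂ H}
    (hα : α ∈ Omega1 π D) (hT : ∀ a, π a * T = T * π a)
    (hone : ∀ a, (D * π a - π a * D) * S = T * (D * π a - π a * D)) :
    α * S = T * α := by
  obtain ⟨n, a, b, rfl⟩ := hα
  rw [Finset.sum_mul, Finset.mul_sum]
  refine Finset.sum_congr rfl fun i _ => ?_
  rw [mul_assoc, hone, ← mul_assoc, hT, mul_assoc]

theorem Omega1.anticommute {π : A →ₐ[ℂ] Module.End ℂ H} {D α γ : Module.End ℂ H}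
    (hα : α ∈ Omega1 π D) (hγ : ∀ a, γ * π a = π a * γ) (hD : γ * D = -(D * γ)) :
    γ * α = -(α * γ) := by
  have h := Omega1.mul_eq_mul (S := γ) (T := -γ) hα (fun a => by simp [hγ a]) fun a => by
    have h₁ : γ * (D * π a) = -(D * π a * γ) := by
      rw [← mul_assoc, hD, neg_mul, mul_assoc, hγ, mul_assoc]
    have h₂ : γ * (π a * D) = -(π a * D * γ) := by
      rw [← mul_assoc, hγ, mul_assoc, hD, mul_neg, mul_assoc]
    rw [neg_mul, mul_sub, h₁, h₂, sub_mul]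
    abel
  rw [h, neg_mul, neg_neg]

theorem conjAL_anticommute {J : H ≃ₗ⋆[ℂ] H} {α γ : Module.End ℂ H} {ε : ℂ}
    (hε : ε = 1 ∨ ε = -1) (hJ : ∀ h : H, γ (J h) = ε • J (γ h))
    (hα : γ * α = -(α * γ)) : γ * conjAL J α = -(conjAL J α * γ) := by
  have hs (h : H) : γ (J.symm h) = ε • J.symm (γ h) := by
    apply J.injective
    rw [LinearEquiv.map_smulₛₗ, conj_eq_self_of_sign hε, J.apply_symm_apply]
    have := hJ (J.symm h)
    rw [J.apply_symm_apply] at this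
    rw [this, smul_smul, mul_self_eq_one_of_sign hε, one_smul]
  ext h
  have h₁ := LinearMap.congr_fun hα (J.symm h)
  simp only [Module.End.mul_apply, LinearMap.neg_apply] at h₁ ⊢
  rw [conjAL_apply, conjAL_apply, hJ, h₁, hs, map_smul, map_neg, LinearEquiv.map_smulₛₗ,
    conj_eq_self_of_sign hε, smul_neg, smul_smul, mul_self_eq_one_of_sign hε, one_smul]

end TwistedReal

/-- a twisted fluctuation `D_α = D + α + ε′ ν J α J⁻¹ ν` of a
`ν`-twisted real spectral triple admits the same `J` as a `ν`-twisted real structure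
with the same signs, and anticommutes with the grading `γ` when present. -/
theorem fluctuation_preserves_twisted_real_structure
    {A H : Type*} [Ring A] [Algebra ℂ A] [StarRing A]
    [AddCommGroup H] [Module ℂ H]
    (π : A →ₐ[ℂ] Module.End ℂ H) (D : Module.End ℂ H)
    (ν : H ≃ₗ[ℂ] H) (J : H ≃ₗ⋆[ℂ] H)
    (nuhat : A ≃ₐ[ℂ] A) (hcompat : ∀ a : A, π (nuhat a) = ν.conj (π a))
    (ε ε' : ℂ) (hε : ε = 1 ∨ ε = -1) (hε' : ε' = 1 ∨ ε' = -1)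
    (hJ2 : ∀ h : H, J (J h) = ε • h)
    (hzero : ∀ a b : A, π a * conjAL J (π b) = conjAL J (π b) * π a)
    (hone : ∀ a b : A, (D * π a - π a * D) * conjAL J (ν.conj (ν.conj (π b)))
        = conjAL J (π b) * (D * π a - π a * D))
    (heps : ∀ h : H, D (J (ν h)) = ε' • ν (J (D h)))
    (hreg : ∀ h : H, ν (J (ν h)) = J h)
    (α : Module.End ℂ H) (hα : α ∈ Omega1 π D)
    (Dα : Module.End ℂ H)
    (hDα : Dα = D + α + ε' • (ν.toLinearMap * conjAL J α * ν.toLinearMap)) :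
    (∀ a b : A, (Dα * π a - π a * Dα) * conjAL J (ν.conj (ν.conj (π b)))
        = conjAL J (π b) * (Dα * π a - π a * Dα)) ∧
    (∀ h : H, Dα (J (ν h)) = ε' • ν (J (Dα h))) ∧
    (∀ (γ : Module.End ℂ H) (ε'' : ℂ), (ε'' = 1 ∨ ε'' = -1) →
      γ * γ = 1 → (∀ a : A, γ * π a = π a * γ) → γ * D = -(D * γ) →
      γ * ν.toLinearMap = ν.toLinearMap * γ →
      (∀ h : H, γ (J h) = ε'' • J (γ h)) →
      γ * Dα = -(Dα * γ)) := by
  have hν (b : A) : ν.conj (ν.conj (π b)) = π (nuhat (nuhat b)) := by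
    rw [hcompat, hcompat]
  have htw (b : A) : α * conjAL J (π (nuhat (nuhat b))) = conjAL J (π b) * α :=
    Omega1.mul_eq_mul hα (fun a => hzero a b) fun a => by rw [← hν, hone]
  have hνπ (a : A) : ν.toLinearMap * π a = π (nuhat a) * ν.toLinearMap := by
    ext h
    simp [hcompat, LinearEquiv.conj_apply]
  have hcomm (a : A) : ν.toLinearMap * conjAL J α * ν.toLinearMap * π a
      = π a * (ν.toLinearMap * conjAL J α * ν.toLinearMap) := by
    obtain ⟨c, rfl⟩ := nuhat.surjective a
    have h := congrArg (conjAL J) (htw c)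
    rw [conjAL_mul, conjAL_mul, conjAL_conjAL hε hJ2, conjAL_conjAL hε hJ2] at h
    rw [mul_assoc, hνπ, ← mul_assoc, mul_assoc ν.toLinearMap, h, ← mul_assoc, hνπ]
    simp only [mul_assoc]
  refine ⟨fun a b => ?_, fun h => ?_, fun γ ε'' hε'' _ hγπ hγD hγν hγJ => ?_⟩
  · have hred : Dα * π a - π a * Dα = (D * π a - π a * D) + (α * π a - π a * α) := by
      rw [hDα, add_mul, add_mul, mul_add, mul_add, smul_mul_assoc, mul_smul_comm, hcomm]
      abel
    have hfirst : (α * π a - π a * α) * conjAL J (π (nuhat (nuhat b)))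
        = conjAL J (π b) * (α * π a - π a * α) := by
      rw [sub_mul, mul_sub, mul_assoc, hzero, ← mul_assoc, htw, mul_assoc (π a), htw,
        ← mul_assoc (π a), hzero, mul_assoc, mul_assoc]
    rw [hred, add_mul, mul_add, hone, hν, hfirst]
  · have hJα (x : H) : J (conjAL J α x) = α (J x) := by
      simpa [conjAL_apply] using LinearMap.congr_fun (conjAL_conjAL hε hJ2 α) (J x)
    have hαJ (x : H) : conjAL J α (J x) = J (α x) := by simp [conjAL_apply]
    simp only [hDα, LinearMap.add_apply, LinearMap.smul_apply, Module.End.mul_apply,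
      LinearEquiv.coe_coe, heps, hreg, hαJ, hJα, map_add, smul_add, map_smul,
      LinearEquiv.map_smulₛₗ, conj_eq_self_of_sign hε', smul_smul, mul_self_eq_one_of_sign hε',
      one_smul]
    abel
  · have hγα := conjAL_anticommute hε'' hγJ (Omega1.anticommute hα hγπ hγD)
    have hγω : γ * (ν.toLinearMap * conjAL J α * ν.toLinearMap)
        = -(ν.toLinearMap * conjAL J α * ν.toLinearMap * γ) := by
      rw [mul_assoc, ← mul_assoc, hγν, mul_assoc, ← mul_assoc γ, hγα, neg_mul, mul_neg,
        mul_assoc (conjAL J α), hγν]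
      simp only [mul_assoc]
    rw [hDα, mul_add, mul_add, add_mul, add_mul, mul_smul_comm, smul_mul_assoc, hγω, hγD,
      Omega1.anticommute hα hγπ hγD, smul_neg]
    abel
end

section
/- In the graded setting below, the operator D satisfies the ν-twisted order-one condition: for all a, b ∈ B, [D, π(a)] J ν̄²(π(b)) J⁻¹ = J π(b) J⁻¹ [D, π(a)], where ν̄(φ) = ν∘φ∘ν⁻¹ on End(H). Moreover, ν̄(π(a)) = π(ν(a)) for all a ∈ B, so the restriction of ν to B implements an automorphism ν̂ of B in the representation π. -/
section GradedDefs

variable {A : Type*} [Ring A] [Algebra ℂ A] [StarRing A]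

/-- The representation `π(a)(h₊,h₋) = (ν²(a)h₊, ν²(a)h₋)` (multiplication in `A`). -/
def piG (ν : A ≃ₐ[ℂ] A) (a : A) (h : A × A) : A × A :=
  (ν (ν a) * h.1, ν (ν a) * h.2)

/-- The Dirac operator `D(h₊,h₋) = (−q⁻¹ ∂₊(h₋), q ∂₋(h₊))`. -/
noncomputable def DG (q : ℂ) (dp dm : A →ₗ[ℂ] A) (h : A × A) : A × A :=
  (-(q⁻¹ • dp h.2), q • dm h.1)

/-- The reality operator `J(h₊,h₋) = (−h₋*, h₊*)`. -/
def JG (h : A × A) : A × A := (-star h.2, star h.1)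

/-- The inverse `J⁻¹(h₊,h₋) = (h₋*, −h₊*)` of `J`. -/
def JGinv (h : A × A) : A × A := (star h.2, -star h.1)

/-- The grading operator `γ(h₊,h₋) = (h₊, −h₋)`. -/
def gammaG (h : A × A) : A × A := (h.1, -h.2)

/-- The componentwise action of `ν` on `H = H₊ ⊕ H₋`. -/
def nuG (ν : A ≃ₐ[ℂ] A) (h : A × A) : A × A := (ν h.1, ν h.2)

/-- The componentwise action of `ν⁻¹` on `H = H₊ ⊕ H₋`. -/
def nuGinv (ν : A ≃ₐ[ℂ] A) (h : A × A) : A × A := (ν.symm h.1, ν.symm h.2)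

end GradedDefs

/-- in the graded setting, `D` satisfies the `ν`-twisted order-one
condition `[D,π(a)] J ν̄²(π(b)) J⁻¹ = J π(b) J⁻¹ [D,π(a)]` for all `a, b ∈ B = A_e`,
and moreover `ν̄(π(a)) = π(ν(a))`, i.e. `ν` implements its restriction to `B` in the
representation `π`. -/
theorem graded_twisted_order_one
    {G : Type*} [Group G] [DecidableEq G]
    {A : Type*} [Ring A] [Algebra ℂ A] [StarRing A]
    (𝒜 : G → Submodule ℂ A)
    (hinternal : DirectSum.IsInternal 𝒜)
    (hmul : ∀ {g g' : G} {a b : A}, a ∈ 𝒜 g → b ∈ 𝒜 g' → a * b ∈ 𝒜 (g * g'))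
    (hstar : ∀ {g : G} {a : A}, a ∈ 𝒜 g → star a ∈ 𝒜 g⁻¹)
    (Gp : Set G)
    (q : ℝ) (hq0 : 0 < q) (hq1 : q < 1)
    (ν : A ≃ₐ[ℂ] A)
    (hνdeg : ∀ (g : G) (a : A), a ∈ 𝒜 g → ν a ∈ 𝒜 g)
    (hνstar : ∀ a : A, ν (star (ν a)) = star a)
    (dp dm : A →ₗ[ℂ] A)
    (hLp : ∀ a b : A, dp (a * b) = dp a * ν (ν b) + a * dp b)
    (hLm : ∀ a b : A, dm (a * b) = dm a * ν (ν b) + a * dm b)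
    (hqp : ∀ a : A, ν (dp (ν.symm a)) = ((q : ℂ) ^ 2) • dp a)
    (hqm : ∀ a : A, ν (dm (ν.symm a)) = ((q : ℂ) ^ 2)⁻¹ • dm a)
    (hpm : ∀ a : A, ν (star (dp a)) = ν.symm (dm (star a)))
    (hmp : ∀ a : A, ν (star (dm a)) = ν.symm (dp (star a)))
    (Hp Hm : Submodule ℂ A)
    (hHp : Hp = ⨆ g ∈ Gp, 𝒜 g)
    (hHm : Hm = ⨆ g ∈ Gp, 𝒜 g⁻¹)
    (hdp : ∀ a ∈ Hm, dp a ∈ Hp)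
    (hdm : ∀ a ∈ Hp, dm a ∈ Hm)
    (HH : Set (A × A))
    (hHH : HH = {h : A × A | h.1 ∈ Hp ∧ h.2 ∈ Hm})
    :
    (∀ a ∈ 𝒜 (1 : G), ∀ b ∈ 𝒜 (1 : G), ∀ h ∈ HH,
      (DG (q : ℂ) dp dm (piG ν a (JG (nuG ν (nuG ν (piG ν b (nuGinv ν (nuGinv ν (JGinv h))))))))
          - piG ν a (DG (q : ℂ) dp dm (JG (nuG ν (nuG ν (piG ν b (nuGinv ν (nuGinv ν (JGinv h)))))))))
        = JG (piG ν b (JGinv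
            (DG (q : ℂ) dp dm (piG ν a h) - piG ν a (DG (q : ℂ) dp dm h))))) ∧
    (∀ a ∈ 𝒜 (1 : G), ∀ h ∈ HH, nuG ν (piG ν a (nuGinv ν h)) = piG ν (ν a) h) := by
  have star_nu (a : A) : star (ν a) = ν.symm (star a) := by
    rw [← hνstar a, AlgEquiv.symm_apply_apply]
  refine ⟨fun a _ b _ h _ => ?_, fun a _ h _ => ?_⟩
  · ext <;>
      simp [DG, piG, JG, JGinv, nuG, nuGinv, hLp, hLm, star_nu, mul_add, mul_assoc]
  · simp [nuG, piG, nuGinv]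
end
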